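/- arXiv:2605.17384 — 6 statements merged into one kernel-verified Lean document; each statement's English description precedes it below -/
import Mathlib

section
/- Let (t_k)_{k\ge 0} and (a_k)_{k\ge 0} be sequences of nonnegative real numbers satisfying, for all k \ge 0, t_{k+1} \le (1+\varepsilon_k) t_k + \alpha_k a_k + p_k and a_{k+1} \le c\, a_k + \beta_k t_k + b_k, where c \in [0,1) and \varepsilon_k, \alpha_k, \beta_k, p_k, b_k \ge 0. Assume that the series \sum_k \varepsilon_k, \sum_k \alpha_k, \sum_k p_k and \sum_k \beta_k converge, and that \sup_k b_k < \infty. Then \sup_k t_k < \infty and \sup_k a_k < \infty. -/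
/-- Discrete Grönwall inequality with summable relative and absolute perturbations. -/
theorem bddAbove_of_le_one_add_mul_add {u δ q : ℕ → ℝ} (hu : 0 ≤ u 0)
    (hδ : ∀ k, 0 ≤ δ k) (hq : ∀ k, 0 ≤ q k)
    (hrec : ∀ k, u (k + 1) ≤ (1 + δ k) * u k + q k)
    (hδsum : Summable δ) (hqsum : Summable q) : BddAbove (Set.range u) := by
  have key : ∀ n, u n ≤
      Real.exp (∑ i ∈ Finset.range n, δ i) * (u 0 + ∑ i ∈ Finset.range n, q i) := by
    intro n
    induction n with
    | zero => simp
    | succ n ih =>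
      have hQ : 0 ≤ u 0 + ∑ i ∈ Finset.range n, q i :=
        add_nonneg hu (Finset.sum_nonneg fun i _ => hq i)
      have hD : 0 ≤ ∑ i ∈ Finset.range (n + 1), δ i := Finset.sum_nonneg fun i _ => hδ i
      have hexp : (1 + δ n) * Real.exp (∑ i ∈ Finset.range n, δ i) ≤
          Real.exp (∑ i ∈ Finset.range (n + 1), δ i) := by
        rw [Finset.sum_range_succ, add_comm (∑ i ∈ Finset.range n, δ i), Real.exp_add]
        exact mul_le_mul_of_nonneg_right (by linarith [Real.add_one_le_exp (δ n)])
          (Real.exp_pos _).le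
      calc u (n + 1) ≤ (1 + δ n) * u n + q n := hrec n
        _ ≤ (1 + δ n) * (Real.exp (∑ i ∈ Finset.range n, δ i) *
            (u 0 + ∑ i ∈ Finset.range n, q i)) + q n := by
          have := hδ n
          gcongr
        _ ≤ Real.exp (∑ i ∈ Finset.range (n + 1), δ i) * (u 0 + ∑ i ∈ Finset.range n, q i) +
            Real.exp (∑ i ∈ Finset.range (n + 1), δ i) * q n := by
          rw [← mul_assoc]
          exact add_le_add (mul_le_mul_of_nonneg_right hexp hQ)
            (le_mul_of_one_le_left (hq n) (Real.one_le_exp hD))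
        _ = _ := by rw [Finset.sum_range_succ q]; ring
  refine ⟨Real.exp (∑' i, δ i) * (u 0 + ∑' i, q i), ?_⟩
  rintro _ ⟨n, rfl⟩
  have h₁ := hδsum.sum_le_tsum (Finset.range n) fun i _ => hδ i
  have h₂ := hqsum.sum_le_tsum (Finset.range n) fun i _ => hq i
  have h₃ : 0 ≤ u 0 + ∑ i ∈ Finset.range n, q i :=
    add_nonneg hu (Finset.sum_nonneg fun i _ => hq i)
  exact (key n).trans (by gcongr)

/-- Coupled recursion lemma: if nonnegative sequences `t` and `a` satisfy
`t (k+1) ≤ (1 + ε k) * t k + α k * a k + p k` and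
`a (k+1) ≤ c * a k + β k * t k + b k` with `c ∈ [0,1)`, where `ε`, `α`, `p`, `β`
are summable and `b` is bounded above, then both `t` and `a` are bounded above. -/
theorem bddAbove_of_coupled_recursion
    (t a ε α β p b : ℕ → ℝ) (c : ℝ)
    (ht : ∀ k, 0 ≤ t k) (ha : ∀ k, 0 ≤ a k)
    (hε : ∀ k, 0 ≤ ε k) (hα : ∀ k, 0 ≤ α k) (hβ : ∀ k, 0 ≤ β k)
    (hp : ∀ k, 0 ≤ p k) (hb : ∀ k, 0 ≤ b k)
    (hc0 : 0 ≤ c) (hc1 : c < 1)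
    (hrect : ∀ k, t (k + 1) ≤ (1 + ε k) * t k + α k * a k + p k)
    (hreca : ∀ k, a (k + 1) ≤ c * a k + β k * t k + b k)
    (hεsum : Summable ε) (hαsum : Summable α) (hpsum : Summable p)
    (hβsum : Summable β) (hbbdd : BddAbove (Set.range b)) :
    BddAbove (Set.range t) ∧ BddAbove (Set.range a) := by
  obtain ⟨B, hB⟩ := hbbdd
  have hbB : ∀ k, b k ≤ B := fun k => hB ⟨k, rfl⟩
  have hB0 : 0 ≤ B := (hb 0).trans (hbB 0)
  obtain ⟨M, hM0, hM⟩ : ∃ M, 0 ≤ M ∧ c * M + B = M := by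
    have h : 0 < 1 - c := by linarith
    refine ⟨B / (1 - c), by positivity, ?_⟩
    field_simp
    ring
  have hw0 : ∀ k, 0 ≤ max (a k - M) 0 := fun k => le_max_right _ _
  have haw : ∀ k, a k ≤ max (a k - M) 0 + M := fun k => by linarith [le_max_left (a k - M) 0]
  have hV : BddAbove (Set.range fun k => t k + max (a k - M) 0) := by
    refine bddAbove_of_le_one_add_mul_add (δ := fun k => ε k + α k + β k)
      (q := fun k => α k * M + p k) (add_nonneg (ht 0) (hw0 0))
      (fun k => add_nonneg (add_nonneg (hε k) (hα k)) (hβ k))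
      (fun k => add_nonneg (mul_nonneg (hα k) hM0) (hp k)) (fun k => ?_)
      ((hεsum.add hαsum).add hβsum) ((hαsum.mul_right M).add hpsum)
    have hβt : 0 ≤ β k * t k := mul_nonneg (hβ k) (ht k)
    have hw : max (a (k + 1) - M) 0 ≤ max (a k - M) 0 + β k * t k := by
      refine max_le ?_ (add_nonneg (hw0 k) hβt)
      have h₁ := mul_le_mul_of_nonneg_left (haw k) hc0
      have h₂ := mul_le_of_le_one_left (hw0 k) hc1.le
      linarith [hreca k, hbB k]
    have h₁ := mul_le_mul_of_nonneg_left (haw k) (hα k)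
    have h₂ := mul_nonneg (hε k) (hw0 k)
    have h₃ := mul_nonneg (hβ k) (hw0 k)
    have h₄ := mul_nonneg (hα k) (ht k)
    linarith [hrect k]
  obtain ⟨C, hC⟩ := hV
  have hVC : ∀ k, t k + max (a k - M) 0 ≤ C := fun k => hC ⟨k, rfl⟩
  refine ⟨⟨C, ?_⟩, ⟨C + M, ?_⟩⟩
  · rintro _ ⟨k, rfl⟩
    linarith [hVC k, hw0 k]
  · rintro _ ⟨k, rfl⟩
    linarith [hVC k, haw k, ht k]
end

section
/- Let E be a finite-dimensional real inner product space and let U and V be subspaces of E. Then \|P_U \circ P_V - P_{U \cap V}\| < 1, where P_W denotes the orthogonal projection of E onto the subspace W and \|\cdot\| is the operator norm. -/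
open Submodule Metric

variable {E : Type*} [NormedAddCommGroup E] [InnerProductSpace ℝ E] [FiniteDimensional ℝ E]

/-- The orthogonal projection of `E` onto a subspace `W`, as a continuous linear map `E →L[ℝ] E`. -/
noncomputable def projL (W : Submodule ℝ E) : E →L[ℝ] E :=
  W.subtypeL.comp (orthogonalProjection W)

theorem projL_eq_starProjection (W : Submodule ℝ E) : projL W = W.starProjection := rfl

/-- On a finite-dimensional space, a linear map that strictly shrinks every nonzero vector has
operator norm less than `1`. -/
theorem ContinuousLinearMap.norm_lt_one_of_forall_norm_apply_lt
    {E F : Type*} [NormedAddCommGroup E] [NormedSpace ℝ E] [FiniteDimensional ℝ E]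
    [NormedAddCommGroup F] [NormedSpace ℝ F] (T : E →L[ℝ] F)
    (hT : ∀ x, x ≠ 0 → ‖T x‖ < ‖x‖) : ‖T‖ < 1 := by
  have : ProperSpace E := FiniteDimensional.proper ℝ E
  obtain ⟨x₀, hx₀, hmax⟩ := (isCompact_closedBall (0 : E) 1).exists_isMaxOn
    ⟨0, by simp⟩ (f := fun x => ‖T x‖) (by fun_prop)
  have hle : ‖T‖ ≤ ‖T x₀‖ := T.opNorm_le_of_unit_norm (norm_nonneg _) fun z hz =>
    hmax (by simp [hz])
  refine hle.trans_lt ?_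
  by_cases h0 : x₀ = 0
  · simp [h0]
  · exact (hT x₀ h0).trans_le (by simpa using hx₀)

theorem norm_starProjection_starProjection_lt {U V : Submodule ℝ E} {y : E}
    (hy : y ∉ U ⊓ V) : ‖U.starProjection (V.starProjection y)‖ < ‖y‖ := by
  by_contra! h
  have hU := U.norm_starProjection_apply_le (V.starProjection y)
  have hV := V.norm_starProjection_apply_le y
  have hyV : y ∈ V := (V.mem_iff_norm_starProjection y).2 (by linarith)
  have hVy : V.starProjection y = y := V.starProjection_eq_self_iff.2 hyV
  rw [hVy] at h hU
  exact hy ⟨(U.mem_iff_norm_starProjection y).2 (by linarith), hyV⟩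

theorem starProjection_starProjection_sub_starProjection_inf (U V : Submodule ℝ E) (x : E) :
    U.starProjection (V.starProjection x) - (U ⊓ V).starProjection x =
      U.starProjection (V.starProjection (x - (U ⊓ V).starProjection x)) := by
  have hW := (U ⊓ V).starProjection_apply_mem x
  rw [map_sub, map_sub, V.starProjection_eq_self_iff.2 hW.2, U.starProjection_eq_self_iff.2 hW.1]

/-- For subspaces `U`, `V` of a finite-dimensional real inner product space `E`,
the operator norm of `P_U ∘ P_V - P_{U ⊓ V}` is strictly less than `1`. -/
theorem norm_projL_comp_projL_sub_projL_inf_lt_one (U V : Submodule ℝ E) :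
    ‖(projL U).comp (projL V) - projL (U ⊓ V)‖ < 1 := by
  refine ContinuousLinearMap.norm_lt_one_of_forall_norm_apply_lt _ fun x hx => ?_
  simp only [projL_eq_starProjection, _root_.sub_apply,
    ContinuousLinearMap.comp_apply]
  rw [starProjection_starProjection_sub_starProjection_inf]
  set y := x - (U ⊓ V).starProjection x with hy
  have hy_orth : y ∈ (U ⊓ V)ᗮ := (U ⊓ V).sub_starProjection_mem_orthogonal x
  by_cases h : y ∈ U ⊓ V
  · have h0 : y = 0 := (Submodule.mem_bot ℝ).1 ((U ⊓ V).inf_orthogonal_eq_bot ▸ ⟨h, hy_orth⟩)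
    simpa [h0] using hx
  · refine (norm_starProjection_starProjection_lt h).trans_le ?_
    rw [hy, ← Submodule.starProjection_orthogonal_val]
    exact Submodule.norm_starProjection_apply_le _ x
end

section
/- Let E be a finite-dimensional real inner product space and W a subspace of E. Let r > 0, \omega \in [0,1], \alpha \ge 0, C \ge 0, and let R : E \to E be twice continuously differentiable on the closed ball of radius 2r centered at 0, with R(0) = 0 and DR(0) = 0. Assume \|D^2 R(u)\| \le C for all u with \|u\| \le 2r, and \|D^2 R(u)[v,w]\| \le \alpha \|v\| \|w\| for all u with \|u\| \le 2r and all v, w \in W. Then for all u_1, u_2 \in E with \|u_i\| \le r and \|P_{W^\perp} u_i\| \le \omega r for i = 1,2, one has \|R(u_1) - R(u_2)\| \le (\alpha + C\omega)\, r\, \|P_W(u_1 - u_2)\| + 2 C r\, \|P_{W^\perp}(u_1 - u_2)\|. -/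
open Submodule Metric

variable {E : Type*} [NormedAddCommGroup E] [InnerProductSpace ℝ E] [FiniteDimensional ℝ E]

/-- Mean value inequality that only uses the derivative in the direction of the segment. -/
theorem norm_sub_le_of_hasFDerivWithinAt_segment {F G : Type*}
    [NormedAddCommGroup F] [NormedSpace ℝ F] [NormedAddCommGroup G] [NormedSpace ℝ G]
    {f : F → G} {f' : F → F →L[ℝ] G} {s : Set F} {x y : F} {K : ℝ}
    (hf : ∀ z ∈ s, HasFDerivWithinAt f (f' z) s z) (hs : segment ℝ x y ⊆ s)
    (hK : ∀ z ∈ segment ℝ x y, ‖f' z (y - x)‖ ≤ K) : ‖f y - f x‖ ≤ K := by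
  have hmem : ∀ t ∈ Set.Icc (0 : ℝ) 1, x + t • (y - x) ∈ segment ℝ x y := by
    intro t ht
    rw [segment_eq_image']
    exact ⟨t, ht, rfl⟩
  have hline : ∀ t : ℝ, HasDerivWithinAt (fun t : ℝ => x + t • (y - x)) (y - x)
      (Set.Icc 0 1) t := fun t => by
    simpa using (((hasDerivAt_id t).smul_const (y - x)).const_add x).hasDerivWithinAt
  have h := norm_image_sub_le_of_norm_deriv_le_segment_01'
    (f := fun t : ℝ => f (x + t • (y - x))) (f' := fun t => f' (x + t • (y - x)) (y - x)) (C := K)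
    (fun t ht => (hf _ (hs (hmem t ht))).comp_hasDerivWithinAt t (hline t)
      fun u hu => hs (hmem u hu))
    (fun t ht => hK _ (hmem t (Set.Ico_subset_Icc_self ht)))
  simpa using h

theorem projL_add_projL_orthogonal (W : Submodule ℝ E) (u : E) :
    projL W u + projL Wᗮ u = u :=
  W.starProjection_add_starProjection_orthogonal u

theorem projL_mem (W : Submodule ℝ E) (u : E) : projL W u ∈ W :=
  (W.orthogonalProjectionOnto u).2

theorem norm_projL_le (W : Submodule ℝ E) (u : E) : ‖projL W u‖ ≤ ‖u‖ :=
  W.norm_orthogonalProjectionOnto_apply_le u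

/-- Lipschitz-type estimate for a residual map `R` with `R 0 = 0` and `DR 0 = 0` whose second
derivative is bounded by `C` on `closedBall 0 (2r)` and bounded by `α ‖v‖ ‖w‖` on pairs of
directions `v, w ∈ W`: for nearly tangent points `u₁, u₂` (norm at most `r`, normal component
at most `ω r`), one has
`‖R u₁ - R u₂‖ ≤ (α + C ω) r ‖P_W (u₁ - u₂)‖ + 2 C r ‖P_{Wᗮ} (u₁ - u₂)‖`. -/
theorem residual_tangent_normal_lipschitz (W : Submodule ℝ E)
    (r ω α C : ℝ) (R : E → E)
    (hr : 0 < r) (hω0 : 0 ≤ ω) (hω1 : ω ≤ 1) (hα : 0 ≤ α) (hC : 0 ≤ C)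
    (hR : ContDiffOn ℝ 2 R (closedBall (0 : E) (2 * r)))
    (hR0 : R 0 = 0)
    (hDR0 : fderivWithin ℝ R (closedBall (0 : E) (2 * r)) 0 = 0)
    (hD2 : ∀ u : E, ‖u‖ ≤ 2 * r →
      ‖fderivWithin ℝ (fderivWithin ℝ R (closedBall (0 : E) (2 * r)))
        (closedBall (0 : E) (2 * r)) u‖ ≤ C)
    (hD2W : ∀ u : E, ‖u‖ ≤ 2 * r → ∀ v ∈ W, ∀ w ∈ W,
      ‖fderivWithin ℝ (fderivWithin ℝ R (closedBall (0 : E) (2 * r)))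
        (closedBall (0 : E) (2 * r)) u v w‖ ≤ α * ‖v‖ * ‖w‖) :
    ∀ u₁ u₂ : E, ‖u₁‖ ≤ r → ‖u₂‖ ≤ r →
      ‖projL Wᗮ u₁‖ ≤ ω * r → ‖projL Wᗮ u₂‖ ≤ ω * r →
      ‖R u₁ - R u₂‖ ≤
        (α + C * ω) * r * ‖projL W (u₁ - u₂)‖ + 2 * C * r * ‖projL Wᗮ (u₁ - u₂)‖ := by
  intro u₁ u₂ hu₁ hu₂ hp₁ hp₂
  set B := closedBall (0 : E) (2 * r) with hB
  have memB : ∀ {u : E}, u ∈ B ↔ ‖u‖ ≤ 2 * r := mem_closedBall_zero_iff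
  have hconv : Convex ℝ B := convex_closedBall 0 (2 * r)
  have hud : UniqueDiffOn ℝ B := uniqueDiffOn_convex hconv
    ⟨0, ball_subset_interior_closedBall (mem_ball_self (by positivity))⟩
  have hd1 : ∀ z ∈ B, HasFDerivWithinAt R (fderivWithin ℝ R B z) B z := fun z hz =>
    (hR.differentiableOn (by norm_num) z hz).hasFDerivWithinAt
  have hd2 : ∀ z ∈ B, HasFDerivWithinAt (fderivWithin ℝ R B)
      (fderivWithin ℝ (fderivWithin ℝ R B) B z) B z := fun z hz =>
    ((hR.fderivWithin hud (m := 1) (by norm_num)).differentiableOn (by norm_num) z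
      hz).hasFDerivWithinAt
  have h0B : (0 : E) ∈ B := mem_closedBall_self (by positivity)
  have radial : ∀ (x w : E) (K : ℝ), x ∈ B →
      (∀ z ∈ B, ‖fderivWithin ℝ (fderivWithin ℝ R B) B z x w‖ ≤ K) →
      ‖fderivWithin ℝ R B x w‖ ≤ K := by
    intro x w K hx hK
    have hseg := hconv.segment_subset h0B hx
    have h := norm_sub_le_of_hasFDerivWithinAt_segment (x := 0) (y := x) (K := K)
      (f := fun z => fderivWithin ℝ R B z w)
      (f' := fun z => (ContinuousLinearMap.apply ℝ E w).comp
        (fderivWithin ℝ (fderivWithin ℝ R B) B z))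
      (fun z hz => (ContinuousLinearMap.apply ℝ E w).hasFDerivAt.comp_hasFDerivWithinAt z
        (hd2 z hz)) hseg
      (fun z hz => by simpa using hK z (hseg hz))
    simpa [hDR0] using h
  have bilin : ∀ z ∈ B, ∀ v w : E,
      ‖fderivWithin ℝ (fderivWithin ℝ R B) B z v w‖ ≤ C * ‖v‖ * ‖w‖ := fun z hz v w =>
    (ContinuousLinearMap.le_opNorm₂ _ v w).trans (by gcongr; exact hD2 z (memB.1 hz))
  have segment_norm : ∀ x ∈ segment ℝ u₂ u₁, ‖x‖ ≤ r := fun x hx =>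
    mem_closedBall_zero_iff.1 ((convex_closedBall (0 : E) r).segment_subset
      (mem_closedBall_zero_iff.2 hu₂) (mem_closedBall_zero_iff.2 hu₁) hx)
  have segment_normal : ∀ x ∈ segment ℝ u₂ u₁, ‖projL Wᗮ x‖ ≤ ω * r := fun x hx =>
    mem_closedBall_zero_iff.1 (((convex_closedBall (0 : E) (ω * r)).linear_preimage
      (projL Wᗮ).toLinearMap).segment_subset
      (mem_closedBall_zero_iff.2 hp₂) (mem_closedBall_zero_iff.2 hp₁) hx)
  have hsegB : segment ℝ u₂ u₁ ⊆ B := fun x hx =>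
    memB.2 ((segment_norm x hx).trans (by linarith))
  refine norm_sub_le_of_hasFDerivWithinAt_segment hd1 hsegB fun x hx => ?_
  have hxr := segment_norm x hx
  have tangent : ‖fderivWithin ℝ R B x (projL W (u₁ - u₂))‖ ≤
      (α + C * ω) * r * ‖projL W (u₁ - u₂)‖ := by
    refine radial _ _ _ (hsegB hx) fun z hz => ?_
    nth_rewrite 1 [← projL_add_projL_orthogonal W x]
    rw [map_add, add_apply]
    calc _ ≤ α * ‖projL W x‖ * ‖projL W (u₁ - u₂)‖ +
          C * ‖projL Wᗮ x‖ * ‖projL W (u₁ - u₂)‖ :=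
          norm_add_le_of_le (hD2W z (memB.1 hz) _ (projL_mem W x) _ (projL_mem W _))
            (bilin z hz _ _)
      _ ≤ α * r * ‖projL W (u₁ - u₂)‖ + C * (ω * r) * ‖projL W (u₁ - u₂)‖ := by
          gcongr
          · exact (norm_projL_le W x).trans hxr
          · exact segment_normal x hx
      _ = _ := by ring
  have normal : ‖fderivWithin ℝ R B x (projL Wᗮ (u₁ - u₂))‖ ≤
      2 * C * r * ‖projL Wᗮ (u₁ - u₂)‖ := by
    refine radial _ _ _ (hsegB hx) fun z hz => (bilin z hz _ _).trans ?_
    gcongr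
    linarith
  nth_rewrite 1 [← projL_add_projL_orthogonal W (u₁ - u₂)]
  rw [map_add]
  exact norm_add_le_of_le tangent normal
end

section
/- Let X be a metric space, let K \subseteq X be a nonempty compact set, let M_1, M_2 \subseteq X be sets, and let \varphi : X \to X. Assume that for every u \in K there exist \delta_u > 0 and \tau_u \in [0,1) such that for every x \in M_1 with dist(x,u) < \delta_u one has infDist(\varphi(x), M_2) \le \tau_u \cdot infDist(x, M_2). Then there exist \delta > 0 and \tau \in [0,1) such that for every x \in M_1 with infDist(x, K) < \delta one has infDist(\varphi(x), M_2) \le \tau \cdot infDist(x, M_2). -/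
open Metric

/-- Uniformization over a compact set of a pointwise local contraction property: if for each
`u ∈ K` there is a radius and contraction factor valid near `u`, then there are a single radius
`δ > 0` and factor `τ ∈ [0,1)` valid on the whole `δ`-neighborhood of `K`. -/
theorem uniform_contraction_of_local
    {X : Type*} [MetricSpace X] (K M₁ M₂ : Set X) (φ : X → X)
    (hK : IsCompact K) (hKne : K.Nonempty)
    (h : ∀ u ∈ K, ∃ δ > (0 : ℝ), ∃ τ : ℝ, 0 ≤ τ ∧ τ < 1 ∧
      ∀ x ∈ M₁, dist x u < δ → infDist (φ x) M₂ ≤ τ * infDist x M₂) :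
    ∃ δ > (0 : ℝ), ∃ τ : ℝ, 0 ≤ τ ∧ τ < 1 ∧
      ∀ x ∈ M₁, infDist x K < δ → infDist (φ x) M₂ ≤ τ * infDist x M₂ := by
  have key : ∃ τ : ℝ, 0 ≤ τ ∧ τ < 1 ∧
      {x | x ∈ M₁ → infDist (φ x) M₂ ≤ τ * infDist x M₂} ∈ nhdsSet K := by
    refine hK.induction_on (p := fun s => ∃ τ : ℝ, 0 ≤ τ ∧ τ < 1 ∧
      {x | x ∈ M₁ → infDist (φ x) M₂ ≤ τ * infDist x M₂} ∈ nhdsSet s) ?_ ?_ ?_ ?_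
    · exact ⟨0, le_rfl, zero_lt_one, by simp⟩
    · rintro s t hst ⟨τ, h0, h1, hτ⟩
      exact ⟨τ, h0, h1, nhdsSet_mono hst hτ⟩
    · rintro s t ⟨τ, h0, h1, hτ⟩ ⟨σ, -, h1', hσ⟩
      refine ⟨max τ σ, le_max_of_le_left h0, max_lt h1 h1', ?_⟩
      rw [nhdsSet_union]
      refine Filter.mem_sup.2 ⟨Filter.mem_of_superset hτ ?_, Filter.mem_of_superset hσ ?_⟩
      · exact fun x hx hxM => (hx hxM).trans
          (mul_le_mul_of_nonneg_right (le_max_left τ σ) infDist_nonneg)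
      · exact fun x hx hxM => (hx hxM).trans
          (mul_le_mul_of_nonneg_right (le_max_right τ σ) infDist_nonneg)
    · intro u hu
      obtain ⟨δ, hδ, τ, h0, h1, hτ⟩ := h u hu
      exact ⟨ball u δ, mem_nhdsWithin_of_mem_nhds (ball_mem_nhds u hδ), τ, h0, h1,
        Filter.mem_of_superset (isOpen_ball.mem_nhdsSet_self) fun x hx hxM => hτ x hxM hx⟩
  obtain ⟨τ, h0, h1, hτ⟩ := key
  obtain ⟨δ, hδ, hsub⟩ := (hasBasis_nhdsSet_thickening hK).mem_iff.1 hτ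
  refine ⟨δ, hδ, τ, h0, h1, fun x hxM hx => hsub ?_ hxM⟩
  exact mem_thickening_iff.2 ((infDist_lt_iff hKne).1 hx)
end

section
/- Let E be a real Banach space, let \varphi : E \to E be twice continuously differentiable on a neighborhood of a point x, and let c : \mathbb{R} \to E be twice continuously differentiable on a neighborhood of 0 with c(0) = x and \varphi(c(t)) = c(t) for all t in a neighborhood of 0. Let P : E \to E be a continuous linear map satisfying P \circ D\varphi(x) = P. Then P\big( D^2\varphi(x)[c'(0), c'(0)] \big) = 0. -/
/-- If `φ` is `C²` near `x`, `c` is a `C²` curve through `x` that is fixed by `φ` near `0`,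
and `P` is a continuous linear map with `P ∘ Dφ(x) = P`, then
`P (D²φ(x)[c'(0), c'(0)]) = 0`. -/
theorem proj_second_derivative_along_fixed_curve
    {E : Type*} [NormedAddCommGroup E] [NormedSpace ℝ E] [CompleteSpace E]
    (φ : E → E) (c : ℝ → E) (x : E) (P : E →L[ℝ] E)
    (hφ : ContDiffAt ℝ 2 φ x)
    (hc : ContDiffAt ℝ 2 c 0)
    (hc0 : c 0 = x)
    (hfix : ∀ᶠ t in nhds (0 : ℝ), φ (c t) = c t)
    (hP : P.comp (fderiv ℝ φ x) = P) :
    P (fderiv ℝ (fderiv ℝ φ) x (deriv c 0) (deriv c 0)) = 0 := by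
  subst hc0
  have hφ' : HasFDerivAt (fderiv ℝ φ) (fderiv ℝ (fderiv ℝ φ) (c 0)) (c 0) :=
    ((hφ.fderiv_right (m := 1) (by norm_num)).differentiableAt one_ne_zero).hasFDerivAt
  have hc' : HasDerivAt (deriv c) (deriv (deriv c) 0) 0 := by
    have h : DifferentiableAt ℝ (fun t => fderiv ℝ c t 1) 0 :=
      ((hc.fderiv_right (m := 1) (by norm_num)).differentiableAt one_ne_zero).clm_apply
        (differentiableAt_const _)
    exact (show DifferentiableAt ℝ (deriv c) 0 from h).hasDerivAt
  have hc1 : HasDerivAt c (deriv c 0) 0 := (hc.differentiableAt two_ne_zero).hasDerivAt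
  have hfix' : deriv c =ᶠ[nhds 0] fun t => fderiv ℝ φ (c t) (deriv c t) := by
    filter_upwards [hfix.eventually_nhds, hc.eventually (by simp),
      hc.continuousAt.eventually (hφ.eventually (by simp))] with t ht hct hφt
    have h := (hφt.differentiableAt two_ne_zero).hasFDerivAt.comp_hasDerivAt t
      (hct.differentiableAt two_ne_zero).hasDerivAt
    exact (Filter.EventuallyEq.deriv_eq ht).symm.trans h.deriv
  have hprod := (hφ'.comp_hasDerivAt 0 hc1).clm_apply hc'
  have key := hc'.unique (hprod.congr_of_eventuallyEq hfix')
  have hPc : P (fderiv ℝ φ (c 0) (deriv (deriv c) 0)) = P (deriv (deriv c) 0) :=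
    DFunLike.congr_fun hP _
  have hPkey := congrArg P key
  rw [map_add] at hPkey
  simp only [Function.comp_apply] at hPkey
  rw [hPc] at hPkey
  exact right_eq_add.mp hPkey
end

section
/- Let X be a complete metric space, let M_1, M_2 \subseteq X be closed sets with M_2 nonempty, let \tau \in [0,1) and C \ge 0, and let (x_k)_{k \ge 1} be a sequence in X such that for all k \ge 1: x_k \in M_1, dist(x_{k+1}, x_k) \le C \cdot infDist(x_k, M_2), and infDist(x_{k+1}, M_2) \le \tau \cdot infDist(x_k, M_2). Then (x_k) converges to some point x^* \in M_1 \cap M_2 and, for every k \ge 1, dist(x_k, x^*) \le (C/(1-\tau))\, \tau^{k-1}\, infDist(x_1, M_2). -/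
open Metric Filter

/-- An R-linearly converging alternating-projection-type sequence: if `x k ∈ M₁`, consecutive
steps are controlled by the distance to `M₂`, and the distance to `M₂` contracts with factor
`τ < 1`, then the sequence converges to a point of `M₁ ∩ M₂` at an R-linear rate. -/
theorem alternating_sequence_converges
    {X : Type*} [MetricSpace X] [CompleteSpace X]
    (M₁ M₂ : Set X) (hM₁ : IsClosed M₁) (hM₂ : IsClosed M₂) (hM₂ne : M₂.Nonempty)
    (τ C : ℝ) (hτ0 : 0 ≤ τ) (hτ1 : τ < 1) (hC : 0 ≤ C)
    (x : ℕ → X)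
    (hmem : ∀ k ≥ 1, x k ∈ M₁)
    (hstep : ∀ k ≥ 1, dist (x (k + 1)) (x k) ≤ C * infDist (x k) M₂)
    (hcontr : ∀ k ≥ 1, infDist (x (k + 1)) M₂ ≤ τ * infDist (x k) M₂) :
    ∃ xstar ∈ M₁ ∩ M₂,
      Tendsto x atTop (nhds xstar) ∧
      ∀ k ≥ 1, dist (x k) xstar ≤ C / (1 - τ) * τ ^ (k - 1) * infDist (x 1) M₂ := by
  have hdist : ∀ n, infDist (x (n + 1)) M₂ ≤ τ ^ n * infDist (x 1) M₂ := by
    intro n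
    induction n with
    | zero => simp
    | succ n ih =>
      calc infDist (x (n + 1 + 1)) M₂ ≤ τ * infDist (x (n + 1)) M₂ := hcontr _ (by omega)
        _ ≤ τ * (τ ^ n * infDist (x 1) M₂) := by gcongr
        _ = τ ^ (n + 1) * infDist (x 1) M₂ := by ring
  have hgeom : ∀ n, dist (x (n + 1)) (x (n + 1 + 1)) ≤ C * infDist (x 1) M₂ * τ ^ n := by
    intro n
    calc dist (x (n + 1)) (x (n + 1 + 1)) ≤ C * infDist (x (n + 1)) M₂ := by
          rw [dist_comm]
          exact hstep _ (by omega)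
      _ ≤ C * (τ ^ n * infDist (x 1) M₂) := by gcongr; exact hdist n
      _ = C * infDist (x 1) M₂ * τ ^ n := by ring
  obtain ⟨a, ha⟩ := cauchySeq_tendsto_of_complete
    (cauchySeq_of_le_geometric τ _ hτ1 hgeom)
  have hzero : infDist a M₂ = 0 := by
    refine tendsto_nhds_unique (((continuous_infDist_pt M₂).tendsto a).comp ha) ?_
    refine squeeze_zero (fun _ => infDist_nonneg) hdist ?_
    simpa using (tendsto_pow_atTop_nhds_zero_of_lt_one hτ0 hτ1).mul_const (infDist (x 1) M₂)
  refine ⟨a, ⟨hM₁.mem_of_tendsto ha (Eventually.of_forall fun n => hmem _ (by omega)),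
    (hM₂.mem_iff_infDist_zero hM₂ne).2 hzero⟩, (tendsto_add_atTop_iff_nat 1).1 ha, ?_⟩
  intro k hk
  obtain ⟨n, rfl⟩ := Nat.exists_eq_add_of_le' hk
  calc dist (x (n + 1)) a ≤ C * infDist (x 1) M₂ * τ ^ n / (1 - τ) :=
        dist_le_of_le_geometric_of_tendsto τ _ hτ1 hgeom ha n
    _ = C / (1 - τ) * τ ^ (n + 1 - 1) * infDist (x 1) M₂ := by
        rw [Nat.add_sub_cancel]
        ring
end
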